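/- Let T, S be bounded linear operators on a complex Hilbert space, r ≥ 1 and λ ≥ 0. Then w(T*S)^{2r} ≤ (1/(2(λ+1)))·‖|T|^{2r} + |S|^{2r}‖·w(T*S)^r + (λ/(4(λ+1)))·‖|T|^{4r} + |S|^{4r}‖ + (λ/(2(λ+1)))·w(|S|^{2r}|T|^{2r}). -/

import Mathlib

open scoped InnerProductSpace NNReal
open ContinuousLinearMap

variable {H : Type*} [NormedAddCommGroup H] [InnerProductSpace ℂ H]

noncomputable def numRadius [CompleteSpace H] (T : H →L[ℂ] H) : ℝ :=
  ⨆ x : {x : H // ‖x‖ = 1}, ‖⟪T x, (x : H)⟫_ℂ‖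

noncomputable def opAbs [CompleteSpace H] (T : H →L[ℂ] H) : H →L[ℂ] H :=
  CFC.sqrt (ContinuousLinearMap.adjoint T * T)

theorem exists_affine_le_rpow {r m : ℝ} (hr : 1 ≤ r) (hm : 0 ≤ m) :
    ∃ k : ℝ, ∀ t : ℝ, 0 ≤ t → m ^ r - k * m + k * t ≤ t ^ r := by
  rcases hm.eq_or_lt with rfl | hm
  · refine ⟨0, fun t ht => ?_⟩
    simpa [Real.zero_rpow (by linarith : r ≠ 0)] using Real.rpow_nonneg ht r
  · refine ⟨m ^ r * r / m, fun t ht => ?_⟩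
    have h := one_add_mul_self_le_rpow_one_add (s := t / m - 1)
      (by have := div_nonneg ht hm.le; linarith) hr
    rw [add_sub_cancel, Real.div_rpow ht hm.le, le_div_iff₀ (Real.rpow_pos_of_pos hm r)] at h
    refine le_of_eq_of_le ?_ h
    field_simp
    ring

/-- Buzano's inequality. -/
theorem norm_inner_mul_norm_inner_le (a b : H) {x : H} (hx : ‖x‖ = 1) :
    2 * (‖⟪a, x⟫_ℂ‖ * ‖⟪x, b⟫_ℂ‖) ≤ ‖a‖ * ‖b‖ + ‖⟪a, b⟫_ℂ‖ := by
  have h := norm_inner_le_norm (𝕜 := ℂ) a (Submodule.reflection (ℂ ∙ x) b)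
  rw [LinearIsometryEquiv.norm_map, Submodule.reflection_singleton_apply] at h
  have e : 2 * (⟪a, x⟫_ℂ * ⟪x, b⟫_ℂ) =
      ⟪a, 2 • (⟪x, b⟫_ℂ / ((‖x‖ : ℂ) ^ 2)) • x - b⟫_ℂ + ⟪a, b⟫_ℂ := by
    simp [hx, two_smul]
    ring
  calc 2 * (‖⟪a, x⟫_ℂ‖ * ‖⟪x, b⟫_ℂ‖) = ‖2 * (⟪a, x⟫_ℂ * ⟪x, b⟫_ℂ)‖ := by simp
    _ ≤ _ := by rw [e]; exact (norm_add_le _ _).trans (by gcongr; exact h)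

theorem norm_inner_apply_self_le (A : H →L[ℂ] H) {x : H} (hx : ‖x‖ = 1) :
    ‖⟪A x, x⟫_ℂ‖ ≤ ‖A‖ := by
  simpa [hx] using (norm_inner_le_norm (𝕜 := ℂ) (A x) x).trans
    (mul_le_mul_of_nonneg_right (A.le_opNorm x) (norm_nonneg x))

theorem re_inner_apply_self_le (A : H →L[ℂ] H) {x : H} (hx : ‖x‖ = 1) :
    (⟪A x, x⟫_ℂ).re ≤ ‖A‖ :=
  (Complex.re_le_norm _).trans (norm_inner_apply_self_le A hx)

section

variable [CompleteSpace H]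

/-- McCarthy's inequality. -/
theorem re_inner_rpow_le {P : H →L[ℂ] H} (hP : 0 ≤ P) {r : ℝ} (hr : 1 ≤ r) {x : H}
    (hx : ‖x‖ = 1) : (⟪P x, x⟫_ℂ).re ^ r ≤ (⟪(P ^ r) x, x⟫_ℂ).re := by
  have hm : 0 ≤ (⟪P x, x⟫_ℂ).re :=
    ((nonneg_iff_isPositive P).1 hP).re_inner_nonneg_left x
  obtain ⟨k, hk⟩ := exists_affine_le_rpow hr hm
  set m := (⟪P x, x⟫_ℂ).re
  have hsa : IsSelfAdjoint P := .of_nonneg hP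
  have hle : cfc (fun t : ℝ => (m ^ r - k * m) + k * t) P ≤ cfc (fun t : ℝ => t ^ r) P := by
    refine cfc_mono (fun t ht => hk t (spectrum_nonneg_of_nonneg hP ht)) (by fun_prop) ?_
    exact (Real.continuous_rpow_const (by linarith)).continuousOn
  rw [← CFC.rpow_eq_cfc_real hP, cfc_const_add _ _ P, cfc_const_mul _ _ P, cfc_id' ℝ P] at hle
  have h := ((le_def _ _).1 hle).re_inner_nonneg_left x
  have hxx : (⟪x, x⟫_ℂ).re = 1 := by
    rw [inner_self_eq_norm_sq_to_K]; simp [hx]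
  simp only [Algebra.algebraMap_eq_smul_one, sub_apply, add_apply, smul_apply, one_apply_eq_self,
    inner_sub_left, inner_add_left, inner_smul_left_eq_smul,
    RCLike.re_to_complex, Complex.sub_re, Complex.add_re, Complex.smul_re, smul_eq_mul, hxx] at h
  linarith

theorem norm_inner_le_numRadius (A : H →L[ℂ] H) {x : H} (hx : ‖x‖ = 1) :
    ‖⟪A x, x⟫_ℂ‖ ≤ numRadius A :=
  le_ciSup (f := fun x : {x : H // ‖x‖ = 1} => ‖⟪A x, (x : H)⟫_ℂ‖)
    ⟨‖A‖, by rintro _ ⟨y, rfl⟩; exact norm_inner_apply_self_le A y.2⟩ ⟨x, hx⟩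

theorem numRadius_nonneg (A : H →L[ℂ] H) : 0 ≤ numRadius A :=
  Real.iSup_nonneg fun _ => norm_nonneg _

theorem numRadius_rpow_le {A : H →L[ℂ] H} {p M : ℝ} (hp : 0 < p) (hM : 0 ≤ M)
    (h : ∀ x : H, ‖x‖ = 1 → ‖⟪A x, x⟫_ℂ‖ ^ p ≤ M) : numRadius A ^ p ≤ M := by
  rw [← Real.le_rpow_inv_iff_of_pos (numRadius_nonneg A) hM hp]
  refine Real.iSup_le (fun x => ?_) (by positivity)
  exact (Real.le_rpow_inv_iff_of_pos (norm_nonneg _) hM hp).2 (h x x.2)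

theorem opAbs_rpow (T : H →L[ℂ] H) {s : ℝ} (hs : 0 ≤ s) :
    opAbs T ^ (2 * s) = (adjoint T * T) ^ s := by
  have hT : 0 ≤ adjoint T * T := star_mul_self_nonneg T
  rw [opAbs, CFC.sqrt_eq_rpow, CFC.rpow_rpow_of_exponent_nonneg _ _ _ (by norm_num) (by linarith)]
  congr 1
  ring

theorem norm_apply_rpow_le (T : H →L[ℂ] H) {r : ℝ} (hr : 1 ≤ r) {x : H} (hx : ‖x‖ = 1) :
    (‖T x‖ ^ r) ^ 2 ≤ (⟪(opAbs T ^ (2 * r)) x, x⟫_ℂ).re := by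
  have hT : 0 ≤ adjoint T * T := star_mul_self_nonneg T
  have h := re_inner_rpow_le hT hr hx
  rw [← opAbs_rpow T (by linarith)] at h
  have e : (⟪(adjoint T * T) x, x⟫_ℂ).re = ‖T x‖ ^ 2 := by
    rw [mul_apply_eq_comp, adjoint_inner_left, inner_self_eq_norm_sq_to_K]
    norm_cast
  rwa [e, ← Real.rpow_pow_comm (norm_nonneg _)] at h

theorem opAbs_rpow_mul_self (T : H →L[ℂ] H) {r : ℝ} (hr : 0 ≤ r) :
    opAbs T ^ (2 * r) * opAbs T ^ (2 * r) = opAbs T ^ (4 * r) := by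
  have h0 : 0 ≤ opAbs T := CFC.sqrt_nonneg _
  rw [← sq, ← CFC.rpow_natCast _ 2 CFC.rpow_nonneg,
    CFC.rpow_rpow_of_exponent_nonneg _ _ _ (by linarith) (by norm_num)]
  congr 1
  push_cast
  ring

theorem norm_apply_sq_eq_re_inner {A : H →L[ℂ] H} (hA : 0 ≤ A) (x : H) :
    ‖A x‖ ^ 2 = (⟪(A * A) x, x⟫_ℂ).re := by
  have hs : adjoint A = A := (IsSelfAdjoint.of_nonneg hA).star_eq
  have h := adjoint_inner_left A x (A x)
  rw [hs] at h
  rw [mul_apply_eq_comp, h, inner_self_eq_norm_sq_to_K]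
  norm_cast

end

theorem stmt6 [CompleteSpace H] (T S : H →L[ℂ] H) (r l : ℝ) (hr : 1 ≤ r) (hl : 0 ≤ l) :
    numRadius (adjoint T * S) ^ (2 * r) ≤
      (1 / (2 * (l + 1))) * ‖opAbs T ^ (2 * r) + opAbs S ^ (2 * r)‖
          * numRadius (adjoint T * S) ^ r
        + (l / (4 * (l + 1))) * ‖opAbs T ^ (4 * r) + opAbs S ^ (4 * r)‖
        + (l / (2 * (l + 1))) * numRadius (opAbs S ^ (2 * r) * opAbs T ^ (2 * r)) := by
  set w := numRadius (adjoint T * S)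
  have hw : 0 ≤ w := numRadius_nonneg _
  set A := opAbs T ^ (2 * r) with hA
  set B := opAbs S ^ (2 * r) with hB
  have hA0 : 0 ≤ A := CFC.rpow_nonneg
  have hB0 : 0 ≤ B := CFC.rpow_nonneg
  have hBA := numRadius_nonneg (B * A)
  refine numRadius_rpow_le (by linarith) (by positivity) fun x hx => ?_
  have hinner : ⟪(adjoint T * S) x, x⟫_ℂ = ⟪S x, T x⟫_ℂ := by
    rw [mul_apply_eq_comp, adjoint_inner_left]
  have hcw : ‖⟪(adjoint T * S) x, x⟫_ℂ‖ ^ r ≤ w ^ r :=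
    Real.rpow_le_rpow (norm_nonneg _) (norm_inner_le_numRadius _ hx) (by linarith)
  have hc : ‖⟪(adjoint T * S) x, x⟫_ℂ‖ ^ r ≤ ‖S x‖ ^ r * ‖T x‖ ^ r := by
    rw [hinner, ← Real.mul_rpow (norm_nonneg _) (norm_nonneg _)]
    exact Real.rpow_le_rpow (norm_nonneg _) (norm_inner_le_norm _ _) (by linarith)
  have hc0 : 0 ≤ ‖⟪(adjoint T * S) x, x⟫_ℂ‖ ^ r := by positivity
  rw [mul_comm 2 r, Real.rpow_mul (norm_nonneg _), Real.rpow_two]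
  set c := ‖⟪(adjoint T * S) x, x⟫_ℂ‖ ^ r
  have hT := norm_apply_rpow_le T hr hx
  have hS := norm_apply_rpow_le S hr hx
  rw [← hA] at hT
  rw [← hB] at hS
  have hAB : (⟪A x, x⟫_ℂ).re + (⟪B x, x⟫_ℂ).re ≤ ‖A + B‖ := by
    simpa [inner_add_left] using re_inner_apply_self_le (A + B) hx
  have hA4B4 : ‖A x‖ ^ 2 + ‖B x‖ ^ 2 ≤ ‖opAbs T ^ (4 * r) + opAbs S ^ (4 * r)‖ := by
    rw [norm_apply_sq_eq_re_inner hA0, norm_apply_sq_eq_re_inner hB0,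
      opAbs_rpow_mul_self T (by linarith), opAbs_rpow_mul_self S (by linarith)]
    simpa [inner_add_left] using
      re_inner_apply_self_le (opAbs T ^ (4 * r) + opAbs S ^ (4 * r)) hx
  have h1 : 2 * c ≤ ‖A + B‖ := by
    nlinarith [sq_nonneg (‖S x‖ ^ r - ‖T x‖ ^ r)]
  have h2 : 2 * c ^ 2 ≤ ‖A + B‖ * w ^ r := by
    nlinarith [mul_le_mul h1 hcw hc0 (norm_nonneg _)]
  have h3 : c ^ 2 ≤ ‖⟪A x, x⟫_ℂ‖ * ‖⟪x, B x⟫_ℂ‖ := by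
    rw [norm_inner_symm x]
    calc c ^ 2 ≤ (‖S x‖ ^ r * ‖T x‖ ^ r) ^ 2 := by gcongr
      _ = (‖T x‖ ^ r) ^ 2 * (‖S x‖ ^ r) ^ 2 := by ring
      _ ≤ _ := mul_le_mul (hT.trans (Complex.re_le_norm _)) (hS.trans (Complex.re_le_norm _))
        (by positivity) (norm_nonneg _)
  have h4 : ‖⟪A x, B x⟫_ℂ‖ ≤ numRadius (B * A) := by
    have h := adjoint_inner_left B x (A x)
    rw [show adjoint B = B from (IsSelfAdjoint.of_nonneg hB0).star_eq] at h
    rw [← h]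
    exact norm_inner_le_numRadius (B * A) hx
  have h5 := norm_inner_mul_norm_inner_le (A x) (B x) hx
  have h6 : 4 * c ^ 2 ≤ ‖opAbs T ^ (4 * r) + opAbs S ^ (4 * r)‖ + 2 * numRadius (B * A) := by
    nlinarith [sq_nonneg (‖A x‖ - ‖B x‖)]
  calc c ^ 2 = (2 * c ^ 2 * 2 + l * (4 * c ^ 2)) / (4 * (l + 1)) := by field_simp; ring
    _ ≤ (‖A + B‖ * w ^ r * 2 + l * (‖opAbs T ^ (4 * r) + opAbs S ^ (4 * r)‖
        + 2 * numRadius (B * A))) / (4 * (l + 1)) := by gcongr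
    _ = _ := by field_simp; ring
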